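/- If there exists no s ∈ S such that θ(s) and s are conjugate in W, then ι(θ) = I(θ), i.e., every twisted involution is a twisted identity. -/

import Mathlib

namespace TwistedIdentitiesPaper

open scoped Classical

variable {B : Type*} {W : Type*} [Group W] {M : CoxeterMatrix B}

/-- The Bruhat order on `W`, defined via the subword property: `u ≤ v` iff every
reduced expression for `v` contains a subword representing `u`. -/
def bruhatLE (cs : CoxeterSystem M W) (u v : W) : Prop :=
  ∀ l : List B, cs.IsReduced l → cs.wordProd l = v →
    ∃ l' : List B, l'.Sublist l ∧ cs.wordProd l' = u

/-- The strict Bruhat order. -/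
def bruhatLT (cs : CoxeterSystem M W) (u v : W) : Prop :=
  bruhatLE cs u v ∧ u ≠ v

/-- The action `w ↦ w ⋅ s̲ᵢ`: `w ⋅ s̲ᵢ = w sᵢ` if `θ(sᵢ) w sᵢ = w`, and
`w ⋅ s̲ᵢ = θ(sᵢ) w sᵢ` otherwise. -/
noncomputable def twistAct (cs : CoxeterSystem M W) (θ : W ≃* W) (w : W) (i : B) : W :=
  if θ (cs.simple i) * w * cs.simple i = w then w * cs.simple i
  else θ (cs.simple i) * w * cs.simple i

/-- `e ⋅ s̲₁ ⋯ s̲ₖ` for a word `s₁ ⋯ sₖ`. -/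
noncomputable def twistProd (cs : CoxeterSystem M W) (θ : W ≃* W) (l : List B) : W :=
  l.foldl (twistAct cs θ) 1

/-- The set of twisted involutions `I(θ) = {w : θ(w) = w⁻¹}`. -/
def twistedInvolutions (θ : W ≃* W) : Set W := {w | θ w = w⁻¹}

/-- The set of twisted identities `ι(θ) = {θ(w⁻¹) w : w ∈ W}`. -/
def twistedIdentities (θ : W ≃* W) : Set W := {w | ∃ v : W, w = θ v⁻¹ * v}

/-- The rank `ρ(w)` of a twisted involution: the least `k` such that
`w = e ⋅ s̲₁ ⋯ s̲ₖ`. -/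
noncomputable def twistRank (cs : CoxeterSystem M W) (θ : W ≃* W) (w : W) : ℕ :=
  sInf {k | ∃ l : List B, l.length = k ∧ twistProd cs θ l = w}

/-- `θ` has the no-odd-flip (NOF) property: for every `s ∈ S` with `θ(s) ≠ s`,
the order of `s θ(s)` is even or infinite. -/
def NOF (cs : CoxeterSystem M W) (θ : W ≃* W) : Prop :=
  ∀ i : B, θ (cs.simple i) ≠ cs.simple i →
    Even (orderOf (cs.simple i * θ (cs.simple i))) ∨
      orderOf (cs.simple i * θ (cs.simple i)) = 0


/-- The map `(t, e) ↦ (sᵢ t sᵢ, e + [t = sᵢ])` on `W × ℤ/2`. -/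
noncomputable def signedConj (cs : CoxeterSystem M W) (i : B) : Function.End (W × ZMod 2) :=
  fun p ↦ (cs.simple i * p.1 * cs.simple i, p.2 + if p.1 = cs.simple i then 1 else 0)

lemma end_mul_apply {α : Type*} (f g : Function.End α) (x : α) : (f * g) x = f (g x) := rfl

lemma signedConj_mul_pow_apply (cs : CoxeterSystem M W) (i j : B) (n : ℕ) (t : W) (e : ZMod 2) :
    ((signedConj cs i * signedConj cs j) ^ n) (t, e) =
      ((cs.simple i * cs.simple j) ^ n * t * ((cs.simple i * cs.simple j) ^ n)⁻¹,
        e + ∑ k ∈ Finset.range (2 * n),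
          if t = ((cs.simple i * cs.simple j) ^ k)⁻¹ * cs.simple j then 1 else 0) := by
  induction n with
  | zero => simp [Function.End.one_def]
  | succ n ih =>
    set r := cs.simple i * cs.simple j with hr
    have hinv : r⁻¹ = cs.simple j * cs.simple i := by simp [hr]
    have hconj : ∀ k : ℕ, cs.simple j * r ^ k = (r ^ k)⁻¹ * cs.simple j := by
      intro k
      have := conj_pow (a := cs.simple j) (b := r) (i := k)
      rw [← inv_pow, hinv, ← mul_inv_eq_iff_eq_mul, ← this, hr]
      congr 1
      simp [mul_assoc]
    clear_value r
    have h₁ : r ^ n * t * (r ^ n)⁻¹ = cs.simple j ↔ t = (r ^ (2 * n))⁻¹ * cs.simple j := by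
      rw [two_mul, pow_add, mul_inv_rev, mul_assoc _ _ (cs.simple j), ← hconj n, mul_inv_eq_iff_eq_mul,
        eq_inv_mul_iff_mul_eq]
    have h₂ : cs.simple j * (r ^ n * t * (r ^ n)⁻¹) * cs.simple j = cs.simple i ↔
        t = (r ^ (2 * n + 1))⁻¹ * cs.simple j := by
      have h₃ : cs.simple j * (r ^ n * t * (r ^ n)⁻¹) * cs.simple j = cs.simple i ↔
          r ^ n * t * (r ^ n)⁻¹ = r⁻¹ * cs.simple j := by
        rw [hinv]
        constructor
        · intro h
          rw [← h]
          simp [mul_assoc]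
        · intro h
          rw [h]
          simp [mul_assoc]
      rw [h₃, mul_inv_eq_iff_eq_mul, mul_assoc r⁻¹, hconj n, ← eq_inv_mul_iff_mul_eq,
        show 2 * n + 1 = n + 1 + n by omega, pow_add, pow_succ, mul_inv_rev, mul_inv_rev]
      simp only [← mul_assoc, ← inv_pow, ← pow_succ, ← pow_add]
    rw [pow_succ', end_mul_apply, ih, end_mul_apply, signedConj, signedConj, Prod.mk.injEq]
    refine ⟨?_, ?_⟩
    · simp only [pow_succ' r n, mul_inv_rev, hinv]
      simp only [hr, mul_assoc]
    · simp only [h₁, h₂]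
      rw [show 2 * (n + 1) = 2 * n + 1 + 1 by ring, Finset.sum_range_succ, Finset.sum_range_succ]
      ring

lemma isLiftable_signedConj (cs : CoxeterSystem M W) : M.IsLiftable (signedConj cs) := by
  intro i j
  funext ⟨t, e⟩
  have hr := cs.simple_mul_simple_pow i j
  rw [signedConj_mul_pow_apply, hr, two_mul, Finset.sum_range_add]
  simp [pow_add, hr, CharTwo.add_self_eq_zero, Function.End.one_def]

/-- The action of `W` on `W × ℤ/2` whose first component is conjugation and whose second component
records the parity of the multiplicity of `t` in right inversion sequences. -/
noncomputable def signedConjHom (cs : CoxeterSystem M W) : W →* Function.End (W × ZMod 2) :=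
  cs.lift ⟨signedConj cs, isLiftable_signedConj cs⟩

lemma signedConjHom_simple (cs : CoxeterSystem M W) (i : B) :
    signedConjHom cs (cs.simple i) = signedConj cs i :=
  cs.lift_apply_simple _ i

lemma signedConjHom_mul_apply (cs : CoxeterSystem M W) (u v : W) (p : W × ZMod 2) :
    signedConjHom cs (u * v) p = signedConjHom cs u (signedConjHom cs v p) := by
  rw [map_mul, end_mul_apply]

lemma signedConjHom_wordProd (cs : CoxeterSystem M W) (ω : List B) (t : W) (e : ZMod 2) :
    signedConjHom cs (cs.wordProd ω) (t, e) =
      (cs.wordProd ω * t * (cs.wordProd ω)⁻¹, e + (cs.rightInvSeq ω).count t) := by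
  induction ω with
  | nil => simp [Function.End.one_def]
  | cons i ω ih =>
    have hiff : cs.wordProd ω * t * (cs.wordProd ω)⁻¹ = cs.simple i ↔
        (cs.wordProd ω)⁻¹ * cs.simple i * cs.wordProd ω = t := by
      rw [mul_inv_eq_iff_eq_mul, mul_assoc, inv_mul_eq_iff_eq_mul, eq_comm]
    rw [cs.wordProd_cons, signedConjHom_mul_apply, ih, signedConjHom_simple, signedConj,
      CoxeterSystem.rightInvSeq, List.count_cons, Prod.mk.injEq]
    refine ⟨by simp [mul_assoc], ?_⟩
    simp only [hiff, beq_iff_eq]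
    push_cast
    ring

lemma signedConjHom_apply (cs : CoxeterSystem M W) (w t : W) (e : ZMod 2) :
    signedConjHom cs w (t, e) = (w * t * w⁻¹, e + (signedConjHom cs w (t, 0)).2) := by
  obtain ⟨ω, rfl⟩ := cs.wordProd_surjective w
  simp [signedConjHom_wordProd]

lemma length_mul_lt_of_signedConjHom_ne_zero (cs : CoxeterSystem M W) {w t : W}
    (h : (signedConjHom cs w (t, 0)).2 ≠ 0) : cs.length (w * t) < cs.length w := by
  obtain ⟨ω, hω, rfl⟩ := cs.exists_isReduced w
  refine (cs.isRightInversion_of_mem_rightInvSeq hω ?_).2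
  by_contra hmem
  exact h (by simp [signedConjHom_wordProd, List.count_eq_zero_of_not_mem hmem])

lemma signedConjHom_simple_eq_one_iff (cs : CoxeterSystem M W) {w : W} {i : B} :
    (signedConjHom cs w (cs.simple i, 0)).2 = 1 ↔ cs.IsRightDescent w i := by
  refine ⟨fun h ↦ length_mul_lt_of_signedConjHom_ne_zero cs (by simp [h]), fun h ↦ ?_⟩
  have hz : (signedConjHom cs (w * cs.simple i) (cs.simple i, 0)).2 = 0 := by
    by_contra hne
    have := length_mul_lt_of_signedConjHom_ne_zero cs hne
    rw [cs.simple_mul_simple_cancel_right] at this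
    exact lt_asymm h this
  have hw : signedConjHom cs w (cs.simple i, 0) =
      signedConjHom cs (w * cs.simple i) (cs.simple i, 1) := by
    conv_lhs => rw [← cs.simple_mul_simple_cancel_right (w := w) i]
    rw [signedConjHom_mul_apply, signedConjHom_simple]
    simp [signedConj]
  rw [hw, signedConjHom_apply, hz, add_zero]

lemma isRightDescent_simple_mul_or_eq (cs : CoxeterSystem M W) {w : W} {i j : B}
    (hi : cs.IsRightDescent w i) :
    cs.IsRightDescent (cs.simple j * w) i ∨ w * cs.simple i * w⁻¹ = cs.simple j := by
  rw [or_iff_not_imp_right]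
  intro hne
  rw [← signedConjHom_simple_eq_one_iff] at hi ⊢
  rw [signedConjHom_mul_apply, signedConjHom_apply cs w, signedConjHom_simple, signedConj]
  simp [hne, hi]

lemma length_map_le (cs : CoxeterSystem M W) (θ : W →* W)
    (hθS : ∀ i : B, ∃ j : B, θ (cs.simple i) = cs.simple j) (w : W) :
    cs.length (θ w) ≤ cs.length w := by
  choose f hf using hθS
  obtain ⟨ω, hω, rfl⟩ := cs.exists_isReduced w
  have hmap : θ (cs.wordProd ω) = cs.wordProd (ω.map f) := by
    simp [CoxeterSystem.wordProd, map_list_prod, Function.comp_def, hf]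
  rw [hmap, hω.eq]
  simpa using cs.length_wordProd_le (ω.map f)

lemma mem_twistedInvolutions_of_mem_twistedIdentities {θ : W ≃* W}
    (hθ : Function.Involutive θ) {w : W} (hw : w ∈ twistedIdentities θ) :
    w ∈ twistedInvolutions θ := by
  obtain ⟨v, rfl⟩ := hw
  simp [twistedInvolutions, hθ v]

theorem statement7 [Finite B] (cs : CoxeterSystem M W) (θ : W ≃* W)
    (hθ : Function.Involutive θ)
    (hθS : ∀ i : B, ∃ j : B, θ (cs.simple i) = cs.simple j)
    (h : ∀ i : B, ¬ IsConj (cs.simple i) (θ (cs.simple i))) :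
    twistedIdentities θ = twistedInvolutions θ := by
  refine Set.Subset.antisymm
    (fun w ↦ mem_twistedInvolutions_of_mem_twistedIdentities hθ) fun w hw ↦ ?_
  have hlen : ∀ w, cs.length (θ w) = cs.length w := fun w ↦
    le_antisymm (length_map_le cs θ.toMonoidHom hθS w)
      (by simpa [hθ w] using length_map_le cs θ.toMonoidHom hθS (θ w))
  induction hn : cs.length w using Nat.strong_induction_on generalizing w with
  | _ n ih =>
    subst hn
    have hw' : θ w = w⁻¹ := hw
    by_cases h1 : w = 1
    · exact ⟨1, by simp [h1]⟩
    obtain ⟨i, hi⟩ := cs.exists_rightDescent_of_ne_one h1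
    obtain ⟨j, hj⟩ := hθS i
    have hθj : θ (cs.simple j) = cs.simple i := by rw [← hj, hθ]
    have hji : cs.length (cs.simple j * w) = cs.length (w * cs.simple i) := by
      rw [← hlen, ← cs.length_inv]
      simp [hθj, hw']
    rcases isRightDescent_simple_mul_or_eq cs (j := j) hi with hd | he
    · have hlt : cs.length (cs.simple j * w * cs.simple i) < cs.length w :=
        hd.trans (hji.trans_lt hi)
      obtain ⟨v, hv⟩ := ih _ hlt (cs.simple j * w * cs.simple i)
        (by simp [twistedInvolutions, hθj, hj, hw', mul_assoc]) rfl
      refine ⟨v * cs.simple i, ?_⟩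
      calc w = cs.simple j * (cs.simple j * w * cs.simple i) * cs.simple i := by simp [mul_assoc]
        _ = θ (v * cs.simple i)⁻¹ * (v * cs.simple i) := by
          rw [hv, mul_inv_rev, map_mul, cs.inv_simple, hj]
          simp only [mul_assoc]
    · exact absurd (isConj_iff.2 ⟨w, he.trans hj.symm⟩) (h i)

end TwistedIdentitiesPaper
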